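/- (Main Theorem, explicit form.) Let r ≥ 2, K ≥ r − 1, let α : Fin K → ℝ be such that the family (1, α 0, …, α (K−1)) is linearly independent over ℚ, and let P > 0, σ² > 0 and ε > 0 be reals. Then there exist positive integers n_1, …, n_{r−1} such that, defining the effective channel matrix A : Matrix (Fin (r−1)) (Fin K) ℂ by A i k = (1 + Complex.exp(2·π·Complex.I·(n_i·α k)))/√2 and Q = A · Aᴴ, the quantity (det(1 + ((P/σ²) : ℂ) • Q)).re is positive and Real.log (det(1 + ((P/σ²) : ℂ) • Q)).re ≥ (r − 1) · Real.log (1 + P/σ²) − ε. -/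

import Mathlib

open Matrix

section Torus

open MeasureTheory Filter Topology UnitAddTorus

variable {d : Type*} [Fintype d]

lemma mFourier_apply_add (m : d → ℤ) (y z : UnitAddTorus d) :
    mFourier m (y + z) = mFourier m y * mFourier m z := by
  simp [mFourier, fourier_apply, smul_add, AddCircle.toCircle_add, Finset.prod_mul_distrib]

lemma mFourier_apply_nsmul (m : d → ℤ) (n : ℕ) (x : UnitAddTorus d) :
    mFourier m (n • x) = mFourier m x ^ n := by
  induction n with
  | zero => simp [mFourier]
  | succ n ih => rw [succ_nsmul, mFourier_apply_add, ih, pow_succ]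

lemma norm_mFourier_apply (m : d → ℤ) (x : UnitAddTorus d) : ‖mFourier m x‖ = 1 := by
  simp [mFourier, fourier_apply, Circle.norm_coe]

lemma volume_real_univ : (volume : Measure (UnitAddTorus d)).real Set.univ = 1 := by
  simp [measureReal_def, volume_pi, Measure.pi_univ]

lemma integral_mFourier_eq_zero {m : d → ℤ} {x : UnitAddTorus d} (hx : mFourier m x ≠ 1) :
    ∫ y, mFourier m y = 0 := by
  have h : ∫ y, mFourier m (y + x) = ∫ y, mFourier m y :=
    integral_add_right_eq_self (fun y => mFourier m y) x
  simp only [mFourier_apply_add, integral_mul_const] at h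
  by_contra h0
  exact hx (mul_left_cancel₀ h0 (by rw [h, mul_one]))

/-- Averages of a nontrivial bounded geometric sequence tend to zero. -/
lemma tendsto_average_pow_zero {z : ℂ} (hz : ‖z‖ ≤ 1) (hz1 : z ≠ 1) :
    Tendsto (fun N : ℕ => (N : ℂ)⁻¹ * ∑ n ∈ Finset.range N, z ^ (n + 1)) atTop (𝓝 0) := by
  have hbound (N : ℕ) :
      ‖(N : ℂ)⁻¹ * ∑ n ∈ Finset.range N, z ^ (n + 1)‖ ≤ (N : ℝ)⁻¹ * (2 / ‖z - 1‖) := by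
    simp only [pow_succ]
    rw [← Finset.sum_mul, geom_sum_eq hz1, norm_mul, norm_inv, Complex.norm_natCast, norm_mul,
      norm_div]
    gcongr
    calc ‖z ^ N - 1‖ / ‖z - 1‖ * ‖z‖ ≤ ‖z ^ N - 1‖ / ‖z - 1‖ * 1 := by gcongr
      _ ≤ 2 / ‖z - 1‖ := by
        rw [mul_one]
        gcongr
        calc ‖z ^ N - 1‖ ≤ ‖z‖ ^ N + ‖(1 : ℂ)‖ := by rw [← norm_pow]; exact norm_sub_le _ _
          _ ≤ 2 := by rw [norm_one]; linarith [pow_le_one₀ (n := N) (norm_nonneg z) hz]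
  refine squeeze_zero_norm hbound ?_
  simpa using (tendsto_inv_atTop_nhds_zero_nat (𝕜 := ℝ)).mul_const (2 / ‖z - 1‖)

/-- Weyl's criterion for trigonometric polynomials. -/
lemma tendsto_average_of_mem_span_mFourier {x : UnitAddTorus d}
    (hx : ∀ m : d → ℤ, mFourier m x = 1 → m = 0) {p : C(UnitAddTorus d, ℂ)}
    (hp : p ∈ Submodule.span ℂ (Set.range (mFourier (d := d)))) :
    Tendsto (fun N : ℕ => (N : ℂ)⁻¹ * ∑ n ∈ Finset.range N, p ((n + 1) • x)) atTop
      (𝓝 (∫ y, p y)) := by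
  induction hp using Submodule.span_induction with
  | mem p hp =>
    obtain ⟨m, rfl⟩ := hp
    simp only [mFourier_apply_nsmul]
    by_cases hm : m = 0
    · subst hm
      refine tendsto_const_nhds.congr' ?_
      filter_upwards [eventually_gt_atTop 0] with N hN
      have : (N : ℂ) ≠ 0 := by exact_mod_cast hN.ne'
      simp [mFourier_zero, this, volume_real_univ]
    · have h1 : mFourier m x ≠ 1 := fun h => hm (hx m h)
      rw [integral_mFourier_eq_zero h1]
      exact tendsto_average_pow_zero (norm_mFourier_apply m x).le h1
  | zero => simp
  | add p q _ _ hp hq =>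
    have hi (f : C(UnitAddTorus d, ℂ)) : Integrable f :=
      f.continuous.integrable_of_hasCompactSupport (.of_compactSpace _)
    simpa [Finset.sum_add_distrib, mul_add, integral_add (hi p) (hi q)] using hp.add hq
  | smul c p _ hp =>
    simpa [← Finset.mul_sum, integral_const_mul, mul_left_comm] using hp.const_mul c

/-- **Kronecker's theorem**: the positive multiples of a point of the torus that is annihilated by
no nontrivial character are dense. -/
theorem denseRange_succ_nsmul {x : UnitAddTorus d}
    (hx : ∀ m : d → ℤ, mFourier m x = 1 → m = 0) :
    DenseRange (fun n : ℕ => (n + 1) • x) := by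
  by_contra hdense
  obtain ⟨b, hb⟩ : ∃ b, b ∉ closure (Set.range fun n : ℕ => (n + 1) • x) := by
    simpa [DenseRange, Dense] using hdense
  set S := Set.range fun n : ℕ => (n + 1) • x
  have hne : S.Nonempty := Set.range_nonempty _
  let f : UnitAddTorus d → ℝ := fun y => Metric.infDist y S
  have hf : Continuous f := Metric.continuous_infDist_pt S
  have hf0 (n : ℕ) : f ((n + 1) • x) = 0 := Metric.infDist_zero_of_mem ⟨n, rfl⟩
  have hfb : f b ≠ 0 := fun h => hb ((Metric.mem_closure_iff_infDist_zero hne).2 h)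
  have hpos : 0 < ∫ y, f y :=
    hf.integral_pos_of_hasCompactSupport_nonneg_nonzero (.of_compactSpace _)
      (fun _ => Metric.infDist_nonneg) hfb
  let F : C(UnitAddTorus d, ℂ) := ⟨fun y => (f y : ℂ), by fun_prop⟩
  have hF : F ∈ (Submodule.span ℂ (Set.range (mFourier (d := d)))).topologicalClosure := by
    rw [span_mFourier_closure_eq_top]; trivial
  obtain ⟨p, hp, hFp⟩ := Metric.mem_closure_iff.1 hF ((∫ y, f y) / 2) (half_pos hpos)
  have hnear (y : UnitAddTorus d) : ‖F y - p y‖ ≤ dist F p := by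
    rw [← dist_eq_norm]; exact ContinuousMap.dist_apply_le_dist y
  have hint : ‖∫ y, p y‖ ≤ dist F p := by
    refine le_of_tendsto (tendsto_average_of_mem_span_mFourier hx hp).norm (.of_forall fun N => ?_)
    have hterm (n : ℕ) : ‖p ((n + 1) • x)‖ ≤ dist F p := by
      simpa [F, hf0] using hnear ((n + 1) • x)
    rw [norm_mul, norm_inv, Complex.norm_natCast]
    calc (N : ℝ)⁻¹ * ‖∑ n ∈ Finset.range N, p ((n + 1) • x)‖
        ≤ (N : ℝ)⁻¹ * (N * dist F p) := by
          gcongr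
          simpa using norm_sum_le_of_le (Finset.range N) fun n _ => hterm n
      _ ≤ dist F p := by
          rw [← mul_assoc]
          exact mul_le_of_le_one_left dist_nonneg inv_mul_le_one
  have hi (g : C(UnitAddTorus d, ℂ)) : Integrable g :=
    g.continuous.integrable_of_hasCompactSupport (.of_compactSpace _)
  have hsub : ‖(∫ y, F y) - ∫ y, p y‖ ≤ dist F p := by
    rw [← integral_sub (hi F) (hi p)]
    simpa [volume_real_univ] using norm_integral_le_of_norm_le_const (μ := (volume : Measure (UnitAddTorus d)))
      (.of_forall hnear)
  have hFint : ‖∫ y, F y‖ = ∫ y, f y := by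
    change ‖∫ y, (f y : ℂ)‖ = _
    rw [integral_complex_ofReal, Complex.norm_real, Real.norm_of_nonneg hpos.le]
  linarith [norm_le_norm_add_norm_sub' (∫ y, F y) (∫ y, p y)]

/-- No nontrivial character of the torus annihilates a point whose coordinates are, together with
`1`, linearly independent over `ℚ`. -/
lemma eq_zero_of_mFourier_coe_eq_one {K : ℕ} {α : Fin K → ℝ}
    (hα : LinearIndependent ℚ (Fin.cons (1 : ℝ) α : Fin (K + 1) → ℝ)) (m : Fin K → ℤ)
    (hm : mFourier m (fun k => (α k : UnitAddCircle)) = 1) : m = 0 := by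
  have hexp : Complex.exp (∑ k, 2 * Real.pi * Complex.I * m k * α k) = 1 := by
    rw [Complex.exp_sum, ← hm]
    simp [mFourier, -fourier_apply, fourier_coe_apply]
  obtain ⟨j, hj⟩ := Complex.exp_eq_one_iff.1 hexp
  have hsum : ∑ k, (m k : ℝ) * α k = j := by
    have h : (2 * Real.pi * Complex.I) * ∑ k, (m k : ℂ) * α k = (2 * Real.pi * Complex.I) * j := by
      rw [Finset.mul_sum, mul_comm _ (j : ℂ), ← hj]
      exact Finset.sum_congr rfl fun k _ => by ring
    exact_mod_cast mul_left_cancel₀ Complex.two_pi_I_ne_zero h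
  have hrel := Fintype.linearIndependent_iff.1 hα
    (Fin.cons (-j : ℚ) fun k => (m k : ℚ)) (by simp [Fin.sum_univ_succ, Rat.smul_def, hsum])
  ext k
  simpa using hrel k.succ

/-- The response of the reference antenna combined with one further antenna, as a function of the
phases of the users at the latter. -/
noncomputable def phaseResponse {ι κ : Type*} (u : ι → UnitAddTorus κ) : Matrix ι κ ℂ :=
  fun i k => (1 + fourier 1 (u i k)) / (Real.sqrt 2 : ℂ)

lemma continuous_phaseResponse {ι κ : Type*} :
    Continuous (phaseResponse : (ι → UnitAddTorus κ) → Matrix ι κ ℂ) :=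
  continuous_matrix fun i k => by
    unfold phaseResponse
    fun_prop

/-- Phases `0` for a user's own antenna and `1 / 2` elsewhere give interference-free channels. -/
lemma exists_phaseResponse_mul_conjTranspose_eq {ι κ : Type*} [Fintype κ] [DecidableEq ι]
    {e : ι → κ} (he : Function.Injective e) :
    ∃ u : ι → UnitAddTorus κ, phaseResponse u * (phaseResponse u)ᴴ = (2 : ℂ) • 1 := by
  classical
  have hhalf : fourier 1 (((1 / 2 : ℝ)) : UnitAddCircle) = (-1 : ℂ) := by
    rw [fourier_coe_apply, ← Complex.exp_pi_mul_I]
    congr 1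
    push_cast
    ring
  have h2 : (Real.sqrt 2 : ℂ) * Real.sqrt 2 = 2 := by
    exact_mod_cast Real.mul_self_sqrt (zero_le_two (α := ℝ))
  have h0 : (Real.sqrt 2 : ℂ) ≠ 0 := left_ne_zero_of_mul (h2 ▸ two_ne_zero)
  refine ⟨fun i k => if k = e i then 0 else ((1 / 2 : ℝ) : UnitAddCircle), ?_⟩
  have hA : phaseResponse (fun i k => if k = e i then 0 else ((1 / 2 : ℝ) : UnitAddCircle)) =
      Matrix.of fun i k => if k = e i then (Real.sqrt 2 : ℂ) else 0 := by
    ext i k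
    simp only [phaseResponse, Matrix.of_apply]
    split_ifs
    · rw [fourier_eval_zero, div_eq_iff h0, h2]
      norm_num
    · rw [hhalf]
      simp
  rw [hA]
  ext i j
  rcases eq_or_ne i j with rfl | hij
  · simp [Matrix.mul_apply, h2]
  · simp [Matrix.mul_apply, he.eq_iff, hij]

end Torus

/-- **Main Theorem (explicit form).**
With `r - 1` desired users among `K` users whose direction cosines `α`, together
with `1`, are linearly independent over `ℚ`, transmit power `P > 0`, noise variance
`σ² > 0` and any `ε > 0`, there exist antenna spacings `n i` such that the sum rate
`log det(I + (P/σ²) Q)` of the effective channel `A i k = (1 + e^{2πj nᵢ αₖ})/√2`,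
`Q = A Aᴴ`, is within `ε` of `(r-1)·log(1 + P/σ²)`. -/
theorem main_theorem_sum_rate
    (r K : ℕ) (hr : 2 ≤ r) (hK : r - 1 ≤ K) (α : Fin K → ℝ)
    (hα : LinearIndependent ℚ (Fin.cons (1 : ℝ) α : Fin (K + 1) → ℝ))
    (P σ2 ε : ℝ) (hP : 0 < P) (hσ2 : 0 < σ2) (hε : 0 < ε) :
    ∃ n : Fin (r - 1) → ℕ, (∀ i, 0 < n i) ∧
      let A : Matrix (Fin (r - 1)) (Fin K) ℂ := fun i k =>
        (1 + Complex.exp (2 * Real.pi * Complex.I * ((n i : ℂ) * (α k : ℂ)))) /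
          (Real.sqrt 2 : ℂ)
      let Q : Matrix (Fin (r - 1)) (Fin (r - 1)) ℂ := A * Aᴴ
      0 < (Matrix.det (1 + ((P / σ2 : ℝ) : ℂ) • Q)).re ∧
        ((r - 1 : ℕ) : ℝ) * Real.log (1 + P / σ2) - ε ≤
          Real.log (Matrix.det (1 + ((P / σ2 : ℝ) : ℂ) • Q)).re := by
  set c := P / σ2
  have hc0 : 0 < c := div_pos hP hσ2
  let x : UnitAddTorus (Fin K) := fun k => (α k : UnitAddCircle)
  have hdense : DenseRange
      (Pi.map fun (_ : Fin (r - 1)) (n : ℕ) => (n + 1) • x) :=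
    DenseRange.piMap fun _ => denseRange_succ_nsmul (eq_zero_of_mFourier_coe_eq_one hα)
  let Φ : (Fin (r - 1) → UnitAddTorus (Fin K)) → ℝ := fun u =>
    (Matrix.det (1 + (c : ℂ) • (phaseResponse u * (phaseResponse u)ᴴ))).re
  have hΦ : Continuous Φ := by
    have := continuous_phaseResponse (ι := Fin (r - 1)) (κ := Fin K)
    fun_prop
  obtain ⟨u, hu⟩ := exists_phaseResponse_mul_conjTranspose_eq (Fin.castLE_injective hK)
  have hΦu : (1 + c) ^ (r - 1) < Φ u := by
    have hval : Φ u = (1 + c * 2) ^ (r - 1) := by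
      have : (1 : Matrix (Fin (r - 1)) (Fin (r - 1)) ℂ) + (c : ℂ) • ((2 : ℂ) • 1) =
          (1 + (c : ℂ) * 2) • 1 := by
        rw [smul_smul, add_smul, one_smul]
      simp only [Φ, hu, this, Matrix.det_smul, Matrix.det_one, Fintype.card_fin, mul_one]
      exact_mod_cast Complex.ofReal_re ((1 + c * 2) ^ (r - 1))
    rw [hval]
    exact pow_lt_pow_left₀ (by linarith) (by linarith) (by omega)
  obtain ⟨n, hn⟩ := hdense.exists_mem_open (isOpen_lt continuous_const hΦ) ⟨u, hΦu⟩
  refine ⟨fun i => n i + 1, fun i => Nat.succ_pos _, ?_⟩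
  intro A Q
  have hA : phaseResponse (Pi.map (fun (_ : Fin (r - 1)) (n : ℕ) => (n + 1) • x) n) = A := by
    ext i k
    have hcoe : (n i + 1) • (α k : UnitAddCircle) =
        (((n i + 1 : ℕ) * α k : ℝ) : UnitAddCircle) := by
      rw [← AddCircle.coe_nsmul, nsmul_eq_mul]
    simp only [phaseResponse, A, Pi.map_apply, Pi.smul_apply, x, hcoe]
    rw [fourier_coe_apply]
    push_cast
    ring_nf
  have hlt : (1 + c) ^ (r - 1) < (Matrix.det (1 + (c : ℂ) • Q)).re := by
    simpa only [Set.mem_ofPred_eq, Φ, hA] using hn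
  have hpow : 0 < (1 + c) ^ (r - 1) := by positivity
  refine ⟨hpow.trans hlt, ?_⟩
  have := Real.log_le_log hpow hlt.le
  rw [Real.log_pow] at this
  linarith
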